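/- Let B be a square non-negative integer matrix such that A = I + B is irreducible. If B' is obtained from B by adding one row of B to a different row, or by adding one column of B to a different column, then A ∼_M I + B'. -/

import Mathlib

/-- A directed graph as used in the theory of graph `C*`-algebras:
a type of vertices, a type of edges, and range and source maps. -/
structure CKGraph : Type 1 where
  V : Type
  E : Type
  r : E → V
  s : E → V

namespace CKGraph

/-- An isomorphism of graphs: bijections of vertices and edges intertwining
the range and source maps. -/
structure Iso (G H : CKGraph) where
  vEquiv : G.V ≃ H.V
  eEquiv : G.E ≃ H.E
  map_r : ∀ e, H.r (eEquiv e) = vEquiv (G.r e)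
  map_s : ∀ e, H.s (eEquiv e) = vEquiv (G.s e)

/-- A vertex is a source if it receives no edges. -/
def IsSource (G : CKGraph) (v : G.V) : Prop := ∀ e, G.r e ≠ v

/-- A vertex is a sink if it emits no edges. -/
def IsSink (G : CKGraph) (v : G.V) : Prop := ∀ e, G.s e ≠ v

/-- A vertex is an infinite emitter if it emits infinitely many edges. -/
def IsInfiniteEmitter (G : CKGraph) (v : G.V) : Prop := {e | G.s e = v}.Infinite

/-- A vertex is regular if it is neither a sink nor an infinite emitter. -/
def Regular (G : CKGraph) (v : G.V) : Prop :=
  (∃ e, G.s e = v) ∧ {e | G.s e = v}.Finite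

/-- There is a (nonempty) path from `u` to `v` in `G`. -/
inductive HasPath (G : CKGraph) : G.V → G.V → Prop
  | single (e : G.E) : HasPath G (G.s e) (G.r e)
  | cons (e : G.E) {v : G.V} : HasPath G (G.r e) v → HasPath G (G.s e) v

/-- `G.Geq u v` is the relation `u ≥ v`: `u = v` or there is a path from `u` to `v`. -/
def Geq (G : CKGraph) (u v : G.V) : Prop := u = v ∨ G.HasPath u v

/-- There is a (nonempty) path from `u` to `v` all of whose vertices lie in `S`. -/
inductive HasPathIn (G : CKGraph) (S : Set G.V) : G.V → G.V → Prop
  | single (e : G.E) : G.s e ∈ S → G.r e ∈ S → HasPathIn G S (G.s e) (G.r e)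
  | cons (e : G.E) {v : G.V} : G.s e ∈ S → HasPathIn G S (G.r e) v →
      HasPathIn G S (G.s e) v

/-- The nonempty list of edges `l` is a path from `u` to `v`. -/
def IsPathFromTo (G : CKGraph) (l : List G.E) (u v : G.V) : Prop :=
  ∃ h : l ≠ [], l.Chain' (fun e f => G.r e = G.s f) ∧
    G.s (l.head h) = u ∧ G.r (l.getLast h) = v

/-- The list of edges `l` is a simple loop based at `v`: a loop at `v` such that the
range of every non-final edge is different from `v`. -/
def IsSimpleLoopAt (G : CKGraph) (v : G.V) (l : List G.E) : Prop :=
  G.IsPathFromTo l v v ∧ ∀ e ∈ l.dropLast, G.r e ≠ v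

/-- A set of vertices is hereditary if it contains the range of every edge whose
source it contains. -/
def Hereditary (G : CKGraph) (H : Set G.V) : Prop := ∀ e, G.s e ∈ H → G.r e ∈ H

/-- A set of vertices is saturated if it contains every regular vertex all of whose
emitted edges have range in the set. -/
def Saturated (G : CKGraph) (H : Set G.V) : Prop :=
  ∀ v, G.Regular v → (∀ e, G.s e = v → G.r e ∈ H) → v ∈ H

/-- Move (S): removing the (regular) source `v` together with all edges it emits. -/
def removeSource (G : CKGraph) (v : G.V) (hsrc : G.IsSource v) : CKGraph where
  V := {w : G.V // w ≠ v}
  E := {e : G.E // G.s e ≠ v}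
  r e := ⟨G.r e.1, hsrc e.1⟩
  s e := ⟨G.s e.1, e.2⟩

/-- Move (R): the reduction at a vertex `u` that emits exactly one edge `f` with
`r f ≠ u` and receives only from the single vertex `v`. -/
def reduce (G : CKGraph) (u : G.V) (f : G.E) (hf : G.s f = u) (hrf : G.r f ≠ u)
    (honly : ∀ e, G.s e = u → e = f) (v : G.V) (hin : ∀ e, G.r e = u → G.s e = v) :
    CKGraph where
  V := {w : G.V // w ≠ u}
  E := {e : G.E // G.r e ≠ u ∧ e ≠ f} ⊕ {e : G.E // G.r e = u}
  r x :=
    match x with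
    | .inl e => ⟨G.r e.1, e.2.1⟩
    | .inr _ => ⟨G.r f, hrf⟩
  s x :=
    match x with
    | .inl e => ⟨G.s e.1, fun h => e.2.2 (honly e.1 h)⟩
    | .inr e => ⟨G.s e.1, by
        intro h
        have h2 : G.r e.1 = u := e.2
        rw [honly e.1 h] at h2
        exact hrf h2⟩

/-- Move (O): the out-split of `G` at `v` according to the partition of `s⁻¹(v)`
into the fibres of `P`. -/
noncomputable def outSplit (G : CKGraph) (v : G.V) (n : ℕ)
    (P : {e : G.E // G.s e = v} → Fin n) : CKGraph :=
  letI := Classical.decEq G.V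
  { V := {w : G.V // w ≠ v} ⊕ Fin n
    E := {e : G.E // G.r e ≠ v} ⊕ ({e : G.E // G.r e = v} × Fin n)
    r := fun x =>
      match x with
      | .inl e => Sum.inl ⟨G.r e.1, e.2⟩
      | .inr p => Sum.inr p.2
    s := fun x =>
      match x with
      | .inl e =>
          if h : G.s e.1 = v then Sum.inr (P ⟨e.1, h⟩) else Sum.inl ⟨G.s e.1, h⟩
      | .inr p =>
          if h : G.s p.1.1 = v then Sum.inr (P ⟨p.1.1, h⟩)
          else Sum.inl ⟨G.s p.1.1, h⟩ }

/-- Move (I): the in-split of `G` at `v` according to the partition of `r⁻¹(v)`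
into the fibres of `P`. -/
noncomputable def inSplit (G : CKGraph) (v : G.V) (n : ℕ)
    (P : {e : G.E // G.r e = v} → Fin n) : CKGraph :=
  letI := Classical.decEq G.V
  { V := {w : G.V // w ≠ v} ⊕ Fin n
    E := {e : G.E // G.s e ≠ v} ⊕ ({e : G.E // G.s e = v} × Fin n)
    s := fun x =>
      match x with
      | .inl e => Sum.inl ⟨G.s e.1, e.2⟩
      | .inr p => Sum.inr p.2
    r := fun x =>
      match x with
      | .inl e =>
          if h : G.r e.1 = v then Sum.inr (P ⟨e.1, h⟩) else Sum.inl ⟨G.r e.1, h⟩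
      | .inr p =>
          if h : G.r p.1.1 = v then Sum.inr (P ⟨p.1.1, h⟩)
          else Sum.inl ⟨G.r p.1.1, h⟩ }

/-- Move-equivalence: the smallest equivalence relation on graphs with finitely many
vertices such that `G ∼ H` whenever `H` is obtained from `G`, up to graph
isomorphism, by one of the moves (S), (I), (O), (R). -/
inductive MoveEquiv : CKGraph → CKGraph → Prop
  | of_iso {G H : CKGraph} (hG : Finite G.V) (h : Nonempty (Iso G H)) : MoveEquiv G H
  | moveS {G : CKGraph} (hG : Finite G.V) (v : G.V) (hreg : G.Regular v)
      (hsrc : G.IsSource v) {H : CKGraph}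
      (h : Nonempty (Iso H (G.removeSource v hsrc))) : MoveEquiv G H
  | moveR {G : CKGraph} (hG : Finite G.V) (u : G.V) (f : G.E) (hf : G.s f = u)
      (hrf : G.r f ≠ u) (honly : ∀ e, G.s e = u → e = f) (v : G.V)
      (hin : ∀ e, G.r e = u → G.s e = v) {H : CKGraph}
      (h : Nonempty (Iso H (G.reduce u f hf hrf honly v hin))) : MoveEquiv G H
  | moveO {G : CKGraph} (hG : Finite G.V) (v : G.V) (hns : ¬ G.IsSink v) (n : ℕ)
      (P : {e : G.E // G.s e = v} → Fin n) (hsurj : Function.Surjective P)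
      (hinf : ∀ i j : Fin n, {x : {e : G.E // G.s e = v} | P x = i}.Infinite →
        {x : {e : G.E // G.s e = v} | P x = j}.Infinite → i = j)
      {H : CKGraph} (h : Nonempty (Iso H (G.outSplit v n P))) : MoveEquiv G H
  | moveI {G : CKGraph} (hG : Finite G.V) (v : G.V) (hreg : G.Regular v)
      (hns : ¬ G.IsSource v) (n : ℕ) (P : {e : G.E // G.r e = v} → Fin n)
      (hsurj : Function.Surjective P) {H : CKGraph}
      (h : Nonempty (Iso H (G.inSplit v n P))) : MoveEquiv G H
  | symm {G H : CKGraph} : MoveEquiv G H → MoveEquiv H G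
  | trans {G H K : CKGraph} : MoveEquiv G H → MoveEquiv H K → MoveEquiv G K

/-- The graph obtained from `G` by collapsing a regular non-source vertex `v` that
emits exactly one edge `f₀`, which is not a loop: delete `v`, `f₀` and all edges into
`v`, and add an edge `[e f₀]` from `s e` to `r f₀` for every edge `e` into `v`. -/
def collapseOne (G : CKGraph) (v : G.V) (f₀ : G.E) (hf : G.s f₀ = v)
    (honly : ∀ e, G.s e = v → e = f₀) (hr : G.r f₀ ≠ v) : CKGraph where
  V := {w : G.V // w ≠ v}
  E := {e : G.E // G.r e ≠ v ∧ e ≠ f₀} ⊕ {e : G.E // G.r e = v}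
  r x :=
    match x with
    | .inl e => ⟨G.r e.1, e.2.1⟩
    | .inr _ => ⟨G.r f₀, hr⟩
  s x :=
    match x with
    | .inl e => ⟨G.s e.1, fun h => e.2.2 (honly e.1 h)⟩
    | .inr e => ⟨G.s e.1, by
        intro h
        have h2 : G.r e.1 = v := e.2
        rw [honly e.1 h] at h2
        exact hr h2⟩

/-- The graph obtained from `G` by collapsing a regular vertex `v` which does not
support a loop of length one: delete `v` and all edges into or out of `v`, and add
an edge `[e f]` from `s e` to `r f` for every pair of edges `e, f` with
`r e = v = s f`. -/
def collapse (G : CKGraph) (v : G.V) (hnl : ∀ e, G.s e = v → G.r e ≠ v) :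
    CKGraph where
  V := {w : G.V // w ≠ v}
  E := {e : G.E // G.r e ≠ v ∧ G.s e ≠ v} ⊕
    ({e : G.E // G.r e = v} × {f : G.E // G.s f = v})
  s x :=
    match x with
    | .inl e => ⟨G.s e.1, e.2.2⟩
    | .inr p => ⟨G.s p.1.1, fun h => hnl p.1.1 h p.1.2⟩
  r x :=
    match x with
    | .inl e => ⟨G.r e.1, e.2.1⟩
    | .inr p => ⟨G.r p.2.1, fun h => hnl p.2.1 p.2.2 h⟩

/-- The graph obtained from `G` by adding countably infinitely many new edges,
each with source `u` and range `w`. -/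
def addEdges (G : CKGraph) (u w : G.V) : CKGraph where
  V := G.V
  E := G.E ⊕ ℕ
  r x := match x with | .inl e => G.r e | .inr _ => w
  s x := match x with | .inl e => G.s e | .inr _ => u

/-- The graph with exactly one vertex and no edges. -/
def singletonGraph : CKGraph where
  V := PUnit
  E := Empty
  r e := e.elim
  s e := e.elim

/-- The Cuntz splice of `G` at `v`: add two new vertices `u₁, u₂` and six new edges:
`v → u₁`, `u₁ → v`, a loop at `u₁`, `u₁ → u₂`, `u₂ → u₁`, and a loop at `u₂`. -/
def cuntzSplice (G : CKGraph) (v : G.V) : CKGraph where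
  V := G.V ⊕ Fin 2
  E := G.E ⊕ Fin 6
  s x :=
    match x with
    | .inl e => Sum.inl (G.s e)
    | .inr i => ![Sum.inl v, Sum.inr 0, Sum.inr 0, Sum.inr 0, Sum.inr 1, Sum.inr 1] i
  r x :=
    match x with
    | .inl e => Sum.inl (G.r e)
    | .inr i => ![Sum.inr 0, Sum.inl v, Sum.inr 0, Sum.inr 1, Sum.inr 0, Sum.inr 1] i

/-- The adjacency matrix (as an integer matrix) of a graph whose vertices are
enumerated by `Fin n`. -/
noncomputable def adjMatrix (G : CKGraph) {n : ℕ} (ρ : G.V ≃ Fin n) :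
    Matrix (Fin n) (Fin n) ℤ :=
  Matrix.of fun i j => (Nat.card {e : G.E // G.s e = ρ.symm i ∧ G.r e = ρ.symm j} : ℤ)

end CKGraph

/-- The graph of an `ℕ∞`-valued square matrix: it has exactly `A x y` edges from
`x` to `y`. -/
def graphOfMatrix {n : ℕ} (A : Matrix (Fin n) (Fin n) ℕ∞) : CKGraph where
  V := Fin n
  E := Σ x : Fin n, Σ y : Fin n, {k : ℕ // (k : ℕ∞) < A x y}
  s e := e.1
  r e := e.2.1

/-- Move-equivalence of (possibly differently sized) square matrices over `ℕ∞`. -/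
def MatMoveEquiv {m n : ℕ} (A : Matrix (Fin m) (Fin m) ℕ∞)
    (B : Matrix (Fin n) (Fin n) ℕ∞) : Prop :=
  CKGraph.MoveEquiv (graphOfMatrix A) (graphOfMatrix B)

/-- A square matrix is irreducible if any index connects to any other index through
a chain of non-zero entries. -/
def MatIrreducible {n : ℕ} {α : Type*} [Zero α] (A : Matrix (Fin n) (Fin n) α) :
    Prop :=
  ∀ i j : Fin n, ∃ (l : ℕ) (c : ℕ → Fin n), 1 ≤ l ∧ c 0 = i ∧ c l = j ∧
    ∀ t < l, A (c t) (c (t + 1)) ≠ 0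

/-- `Jmat n m` is the `n × n` matrix whose top-left `m × m` block is the identity,
whose other entries in the first `m` rows are `0`, and whose last `n - m` rows have
every entry equal to `∞`. -/
def Jmat (n m : ℕ) : Matrix (Fin n) (Fin n) ℕ∞ :=
  Matrix.of fun i j => if i.1 < m then (if i = j then 1 else 0) else ⊤

namespace CKGraph

/-- The graph with given vertices, edges, source and range maps. -/
abbrev ofMaps {V E : Type} (s r : E → V) : CKGraph := ⟨V, E, r, s⟩

/-- The opposite graph. -/
def op (G : CKGraph) : CKGraph := ⟨G.V, G.E, G.s, G.r⟩

theorem nonempty_iso_of_bijective {G H : CKGraph} (fv : G.V → H.V) (fe : G.E → H.E)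
    (hv : fv.Bijective) (he : fe.Bijective) (hr : ∀ e, H.r (fe e) = fv (G.r e))
    (hs : ∀ e, H.s (fe e) = fv (G.s e)) : Nonempty (Iso G H) :=
  ⟨⟨Equiv.ofBijective fv hv, Equiv.ofBijective fe he, hr, hs⟩⟩

theorem nonempty_iso_op {G H : CKGraph} (h : Nonempty (Iso G H)) :
    Nonempty (Iso G.op H.op) :=
  h.map fun φ => ⟨φ.vEquiv, φ.eEquiv, φ.map_s, φ.map_r⟩

theorem op_outSplit (G : CKGraph) (v : G.V) (n : ℕ) (P : {e : G.E // G.s e = v} → Fin n) :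
    (G.outSplit v n P).op = G.op.inSplit v n P := by
  unfold outSplit inSplit op
  congr 1 <;> funext x <;> cases x <;> rfl

theorem moveEquiv_ofMaps_of_equiv {V E F : Type} [Finite V] {s r : E → V} {s' r' : F → V}
    (φ : E ≃ F) (hs : ∀ e, s' (φ e) = s e) (hr : ∀ e, r' (φ e) = r e) :
    MoveEquiv (ofMaps s r) (ofMaps s' r') :=
  .of_iso ‹Finite V› ⟨⟨Equiv.refl V, φ, hr, hs⟩⟩

/-- Subdividing each edge of a finite family does not change the move-equivalence class. -/
theorem moveEquiv_subdivide {V : Type} [Finite V] (F : Type) [Finite F] :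
    ∀ (E : Type) (s r : E → V) (s' r' : F → V),
      MoveEquiv (ofMaps (Sum.elim s s') (Sum.elim r r'))
        (ofMaps (V := V ⊕ F) (Sum.elim (Sum.inl ∘ s) (Sum.elim (Sum.inl ∘ s') Sum.inr))
          (Sum.elim (Sum.inl ∘ r) (Sum.elim Sum.inr (Sum.inl ∘ r')))) := by
  suffices H : Finite F → ∀ (E : Type) (s r : E → V) (s' r' : F → V),
      MoveEquiv (ofMaps (Sum.elim s s') (Sum.elim r r'))
        (ofMaps (V := V ⊕ F) (Sum.elim (Sum.inl ∘ s) (Sum.elim (Sum.inl ∘ s') Sum.inr))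
          (Sum.elim (Sum.inl ∘ r) (Sum.elim Sum.inr (Sum.inl ∘ r')))) from H ‹_›
  induction F using Finite.induction_empty_option with
  | of_equiv φ ih =>
    rename_i F F'
    intro hF' E s r s' r'
    have hF : Finite F := .of_equiv _ φ.symm
    refine .trans ?_ (.trans (ih hF E s r (s' ∘ φ) (r' ∘ φ)) ?_)
    · refine moveEquiv_ofMaps_of_equiv (Equiv.sumCongr (Equiv.refl E) φ.symm) ?_ ?_ <;>
        rintro (e | e) <;> simp
    · refine .of_iso (inferInstanceAs (Finite (V ⊕ F))) ⟨⟨Equiv.sumCongr (Equiv.refl V) φ,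
        Equiv.sumCongr (Equiv.refl E) (Equiv.sumCongr φ φ), ?_, ?_⟩⟩ <;>
        rintro (e | e | e) <;> simp [ofMaps]
  | h_empty =>
    intro _ E s r s' r'
    refine .of_iso ‹Finite V› ⟨⟨(Equiv.sumEmpty V PEmpty).symm,
      Equiv.sumCongr (Equiv.refl E) (Equiv.equivOfIsEmpty _ _), ?_, ?_⟩⟩ <;>
      rintro (e | ⟨⟨⟩⟩) <;> rfl
  | @h_option F hF ih =>
    intro _ E s r s' r'
    refine .trans ?_ (.trans (ih inferInstance (E ⊕ Unit) (Sum.elim s fun _ => s' none)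
      (Sum.elim r fun _ => r' none) (s' ∘ some) (r' ∘ some)) (.symm ?_))
    · refine moveEquiv_ofMaps_of_equiv
        (((Equiv.sumAssoc _ _ _).trans
          (Equiv.sumCongr (Equiv.refl E)
            ((Equiv.sumComm _ _).trans (Equiv.optionEquivSumPUnit F).symm))).symm) ?_ ?_ <;>
        rintro (e | _ | e) <;> rfl
    · refine .moveR (inferInstanceAs (Finite (V ⊕ Option F))) (Sum.inr none)
        (Sum.inr (Sum.inr none)) rfl (by simp [ofMaps]) ?_ (Sum.inl (s' none)) ?_ ?_
      · rintro (e | e | e) <;> simp [ofMaps]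
      · rintro (e | e | e) <;> simp +contextual [ofMaps]
      · let K : CKGraph := ofMaps (V := V ⊕ Option F)
          (Sum.elim (Sum.inl ∘ s) (Sum.elim (Sum.inl ∘ s') Sum.inr))
          (Sum.elim (Sum.inl ∘ r) (Sum.elim Sum.inr (Sum.inl ∘ r')))
        let fv : V ⊕ F → {w : V ⊕ Option F // w ≠ Sum.inr none} :=
          Sum.elim (fun x => ⟨Sum.inl x, by simp⟩) (fun a => ⟨Sum.inr (some a), by simp⟩)
        let fe : (E ⊕ Unit) ⊕ F ⊕ F →
            {e : E ⊕ Option F ⊕ Option F //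
              K.r e ≠ Sum.inr none ∧ e ≠ Sum.inr (Sum.inr none)} ⊕
            {e : E ⊕ Option F ⊕ Option F // K.r e = Sum.inr none} :=
          Sum.elim
            (Sum.elim (fun e => Sum.inl ⟨Sum.inl e, by simp [K]⟩)
              (fun _ => Sum.inr ⟨Sum.inr (Sum.inl none), rfl⟩))
            (Sum.elim (fun a => Sum.inl ⟨Sum.inr (Sum.inl (some a)), by simp [K]⟩)
              (fun a => Sum.inl ⟨Sum.inr (Sum.inr (some a)), by simp [K]⟩))
        have hf : fv.Bijective ∧ fe.Bijective := by
          refine ⟨⟨?_, ?_⟩, ?_, ?_⟩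
          · rintro (a | a) (b | b) h <;> simp_all [fv]
          · rintro ⟨a | _ | a, h⟩
            · exact ⟨Sum.inl a, rfl⟩
            · exact absurd rfl h
            · exact ⟨Sum.inr a, rfl⟩
          · rintro ((a | a) | a | a) ((b | b) | b | b) h <;> simp_all [fe]
          · rintro (⟨a | (_ | a) | (_ | a), h⟩ | ⟨a | (_ | a) | (_ | a), h⟩)
            · exact ⟨Sum.inl (Sum.inl a), rfl⟩
            · exact absurd rfl h.1
            · exact ⟨Sum.inr (Sum.inl a), rfl⟩
            · exact absurd rfl h.2
            · exact ⟨Sum.inr (Sum.inr a), rfl⟩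
            · simp [K] at h
            · exact ⟨Sum.inl (Sum.inr ()), rfl⟩
            · simp [K] at h
            · simp [K] at h
            · simp [K] at h
        refine nonempty_iso_of_bijective fv fe hf.1 hf.2 ?_ ?_
        · rintro ((a | a) | a | a) <;> rfl
        · rintro ((a | a) | a | a) <;> rfl

section Splits

variable {V X Y : Type}

/-- Out-splitting at `j` with one class consisting of a single non-loop edge `j → i`. -/
theorem exists_iso_outSplit_edge (sX rX : X → V) (sY : Y → V) (i j : V) (hij : i ≠ j)
    (hX : ∀ x, rX x ≠ j) (y₀ : Y) (hy₀ : sY y₀ = j) :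
    ∃ P, Function.Surjective P ∧ Nonempty (Iso
      (ofMaps (V := V ⊕ Unit)
        (Sum.elim (Sum.inl ∘ Sum.elim sX sY) (Sum.elim (Sum.inl ∘ sY) Sum.inr))
        (Sum.elim (Sum.inl ∘ Sum.elim rX fun _ => j)
          (Sum.elim (fun _ => Sum.inr ()) fun _ => Sum.inl i)))
      (outSplit (ofMaps (Sum.elim (Sum.elim sX sY) fun _ : Unit => j)
        (Sum.elim (Sum.elim rX fun _ => j) fun _ => i)) j 2 P)) := by
  let := Classical.decEq V
  refine ⟨fun e => Sum.elim (fun _ => 0) (fun _ => 1) e.1, ?_, ?_⟩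
  · intro k
    fin_cases k
    · exact ⟨⟨Sum.inl (Sum.inr y₀), hy₀⟩, rfl⟩
    · exact ⟨⟨Sum.inr (), rfl⟩, rfl⟩
  let fv : V ⊕ Unit → {w : V // w ≠ j} ⊕ Fin 2 :=
    Sum.elim (fun x => if h : x = j then Sum.inr 0 else Sum.inl ⟨x, h⟩) (fun _ => Sum.inr 1)
  let fe : (X ⊕ Y) ⊕ Y ⊕ Unit →
      {e : (X ⊕ Y) ⊕ Unit // Sum.elim (Sum.elim rX fun _ => j) (fun _ => i) e ≠ j} ⊕
      ({e : (X ⊕ Y) ⊕ Unit // Sum.elim (Sum.elim rX fun _ => j) (fun _ => i) e = j} × Fin 2) :=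
    Sum.elim
      (Sum.elim (fun x => Sum.inl ⟨Sum.inl (Sum.inl x), hX x⟩)
        (fun y => Sum.inr (⟨Sum.inl (Sum.inr y), rfl⟩, 0)))
      (Sum.elim (fun y => Sum.inr (⟨Sum.inl (Sum.inr y), rfl⟩, 1))
        (fun _ => Sum.inl ⟨Sum.inr (), hij⟩))
  have hf : fv.Bijective ∧ fe.Bijective := by
    refine ⟨⟨?_, ?_⟩, ?_, ?_⟩
    · rintro (a | a) (b | b) h
      · by_cases ha : a = j <;> by_cases hb : b = j <;> simp_all [fv]
      · by_cases ha : a = j <;> simp_all [fv]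
      · by_cases hb : b = j <;> simp_all [fv]
      · rfl
    · rintro (⟨a, h⟩ | k)
      · exact ⟨Sum.inl a, dif_neg h⟩
      · fin_cases k
        · exact ⟨Sum.inl j, dif_pos rfl⟩
        · exact ⟨Sum.inr (), rfl⟩
    · rintro ((a | a) | a | a) ((b | b) | b | b) h <;> simp_all [fe] <;> cases h <;> rfl
    · rintro (⟨(a | a) | a, h⟩ | ⟨⟨(a | a) | a, h⟩, k⟩)
      · exact ⟨Sum.inl (Sum.inl a), rfl⟩
      · exact absurd rfl h
      · exact ⟨Sum.inr (Sum.inr a), rfl⟩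
      · exact absurd h (hX a)
      · fin_cases k
        · exact ⟨Sum.inl (Sum.inr a), rfl⟩
        · exact ⟨Sum.inr (Sum.inl a), rfl⟩
      · exact absurd h hij
  refine nonempty_iso_of_bijective fv fe hf.1 hf.2 ?_ ?_
  · rintro ((a | a) | a | a)
    · symm; exact dif_neg (hX a)
    · symm; exact dif_pos rfl
    · rfl
    · symm; exact dif_neg hij
  · rintro ((a | a) | a | a)
    · rfl
    · rfl
    · rfl
    · exact dif_pos rfl

/-- Completely out-splitting a vertex that receives exactly one edge. -/
theorem exists_iso_outSplit_complete [Finite Y] (sX rX : X → V) (rY : Y → V) (i : V)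
    (y₀ : Y) :
    ∃ n P, Function.Surjective P ∧ Nonempty (Iso
      (ofMaps (V := V ⊕ Y)
        (Sum.elim (Sum.inl ∘ sX) (Sum.elim Sum.inr fun _ => Sum.inl i))
        (Sum.elim (Sum.inl ∘ rX) (Sum.elim (Sum.inl ∘ rY) Sum.inr)))
      (outSplit (ofMaps (V := V ⊕ Unit)
        (Sum.elim (Sum.inl ∘ sX) (Sum.elim (fun _ : Y => Sum.inr ()) fun _ : Unit => Sum.inl i))
        (Sum.elim (Sum.inl ∘ rX) (Sum.elim (Sum.inl ∘ rY) Sum.inr))) (Sum.inr ()) n P)) := by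
  obtain ⟨n, ⟨ε⟩⟩ := Finite.exists_equiv_fin Y
  refine ⟨n, fun e => Sum.elim (fun _ => ε y₀) (Sum.elim ε fun _ => ε y₀) e.1, ?_, ?_⟩
  · intro k
    exact ⟨⟨Sum.inr (Sum.inl (ε.symm k)), rfl⟩, by simp⟩
  let fv : V ⊕ Y → {w : V ⊕ Unit // w ≠ Sum.inr ()} ⊕ Fin n :=
    Sum.elim (fun x => Sum.inl ⟨Sum.inl x, by simp⟩) (fun y => Sum.inr (ε y))
  let fe : X ⊕ Y ⊕ Y →
      {e : X ⊕ Y ⊕ Unit //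
        Sum.elim (Sum.inl ∘ rX) (Sum.elim (Sum.inl ∘ rY) Sum.inr) e ≠ Sum.inr ()} ⊕
      ({e : X ⊕ Y ⊕ Unit //
        Sum.elim (Sum.inl ∘ rX) (Sum.elim (Sum.inl ∘ rY) Sum.inr) e = Sum.inr ()} × Fin n) :=
    Sum.elim (fun x => Sum.inl ⟨Sum.inl x, by simp⟩)
      (Sum.elim (fun y => Sum.inl ⟨Sum.inr (Sum.inl y), by simp⟩)
        (fun y => Sum.inr (⟨Sum.inr (Sum.inr ()), rfl⟩, ε y)))
  have hf : fv.Bijective ∧ fe.Bijective := by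
    refine ⟨⟨?_, ?_⟩, ?_, ?_⟩
    · rintro (a | a) (b | b) h <;> simp_all [fv]
    · rintro (⟨a | a, h⟩ | k)
      · exact ⟨Sum.inl a, rfl⟩
      · exact absurd rfl h
      · exact ⟨Sum.inr (ε.symm k), by simp [fv]⟩
    · rintro (a | a | a) (b | b | b) h <;> simp_all [fe] <;> cases h <;> rfl
    · rintro (⟨a | a | a, h⟩ | ⟨⟨a | a | a, h⟩, k⟩)
      · exact ⟨Sum.inl a, rfl⟩
      · exact ⟨Sum.inr (Sum.inl a), rfl⟩
      · exact absurd rfl h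
      · simp at h
      · simp at h
      · exact ⟨Sum.inr (Sum.inr (ε.symm k)), by simp [fe]⟩
  refine nonempty_iso_of_bijective fv fe hf.1 hf.2 ?_ ?_
  · rintro (a | a | a) <;> rfl
  · rintro (a | a | a)
    · exact dif_neg (by simp)
    · exact dif_pos rfl
    · exact dif_neg (by simp)

/-- An edge `j → i` may be replaced by the compositions `e f` with `e` an edge into `j`. -/
theorem moveEquiv_column_ofMaps [Finite V] [Finite X] [Finite Y] (sX rX : X → V)
    (sY : Y → V) (i j : V) (hij : i ≠ j) (hX : ∀ x, rX x ≠ j) (y₀ : Y) (hy₀ : sY y₀ = j) :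
    MoveEquiv
      (ofMaps (Sum.elim (Sum.elim sX sY) fun _ : Unit => j)
        (Sum.elim (Sum.elim rX fun _ => j) fun _ => i))
      (ofMaps (Sum.elim (Sum.elim sX sY) sY)
        (Sum.elim (Sum.elim rX fun _ => j) fun _ => i)) := by
  obtain ⟨P, hP, hiso⟩ := exists_iso_outSplit_edge sX rX sY i j hij hX y₀ hy₀
  obtain ⟨n, Q, hQ, hiso'⟩ := exists_iso_outSplit_complete
    (Sum.elim rX fun _ => j) (Sum.elim sX sY) sY i y₀
  have : Finite (ofMaps (Sum.elim (Sum.elim sX sY) fun _ : Unit => j)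
      (Sum.elim (Sum.elim rX fun _ => j) fun _ => i)).E :=
    inferInstanceAs (Finite ((X ⊕ Y) ⊕ Unit))
  refine .trans (.moveO ‹Finite V› j (fun h => h (Sum.inr ()) rfl) 2 P hP
    (fun _ _ h => absurd (Set.toFinite _) h) hiso) ?_
  refine .trans (.moveI (inferInstanceAs (Finite (V ⊕ Unit))) (Sum.inr ())
    ⟨⟨Sum.inr (Sum.inr ()), rfl⟩, ?_⟩ (fun h => h (Sum.inr (Sum.inl y₀)) rfl) n Q hQ
    (op_outSplit _ _ _ _ ▸ nonempty_iso_op hiso')) ?_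
  · have : Finite ((X ⊕ Y) ⊕ Y ⊕ Unit) := inferInstance
    exact Set.toFinite (α := (X ⊕ Y) ⊕ Y ⊕ Unit) _
  · exact .symm (moveEquiv_subdivide Y (X ⊕ Y) _ _ sY fun _ => i)

/-- An edge `i → j` may be replaced by the compositions `f e` with `e` an edge out of `j`. -/
theorem moveEquiv_row_ofMaps [Finite V] [Finite X] [Finite Y] (sX rX : X → V)
    (rY : Y → V) (i j : V) (hij : i ≠ j) (hX : ∀ x, sX x ≠ j) (y₀ : Y) (hy₀ : rY y₀ = j) :
    MoveEquiv
      (ofMaps (Sum.elim (Sum.elim sX fun _ => j) fun _ : Unit => i)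
        (Sum.elim (Sum.elim rX rY) fun _ => j))
      (ofMaps (Sum.elim (Sum.elim sX fun _ => j) fun _ => i)
        (Sum.elim (Sum.elim rX rY) rY)) := by
  obtain ⟨P, hP, hiso⟩ := exists_iso_outSplit_edge rX sX rY i j hij hX y₀ hy₀
  obtain ⟨n, Q, hQ, hiso'⟩ := exists_iso_outSplit_complete
    (Sum.elim sX fun _ => j) (Sum.elim rX rY) rY i y₀
  refine .trans (.moveI ‹Finite V› j ⟨⟨Sum.inl (Sum.inr y₀), rfl⟩,
    Set.toFinite (α := (X ⊕ Y) ⊕ Unit) _⟩ (fun h => h (Sum.inr ()) rfl) 2 P hP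
    (op_outSplit _ _ _ _ ▸ nonempty_iso_op hiso)) ?_
  refine .trans (.moveO (inferInstanceAs (Finite (V ⊕ Unit))) (Sum.inr ())
    (fun h => h (Sum.inr (Sum.inl y₀)) rfl) n Q hQ (fun _ _ h => absurd ?_ h) hiso') ?_
  · exact @Set.toFinite _ _ (@Subtype.finite _ (@Subtype.finite ((X ⊕ Y) ⊕ Y ⊕ Unit) _ _) _)
  · refine .symm (.trans (moveEquiv_subdivide Y (X ⊕ Y) _ _ (fun _ => i) rY)
      (moveEquiv_ofMaps_of_equiv
        (Equiv.sumCongr (Equiv.refl _) (Equiv.sumComm _ _)) ?_ ?_)) <;>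
      rintro (e | e | e) <;> rfl

end Splits

section EdgeCount

variable {V E F : Type}

/-- The number of edges from `x` to `y` of the graph with source map `s` and range map `r`. -/
noncomputable def edgeCount (s r : E → V) (x y : V) : ℕ := Nat.card {e // s e = x ∧ r e = y}

theorem edgeCount_sumElim [Finite E] [Finite F] (s r : E → V) (s' r' : F → V) (x y : V) :
    edgeCount (Sum.elim s s') (Sum.elim r r') x y = edgeCount s r x y + edgeCount s' r' x y := by
  rw [edgeCount, Nat.card_congr Equiv.subtypeSum, Nat.card_sum]
  rfl

theorem edgeCount_comp_equiv (φ : F ≃ E) (s r : E → V) (x y : V) :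
    edgeCount (s ∘ φ) (r ∘ φ) x y = edgeCount s r x y :=
  Nat.card_congr (φ.subtypeEquiv fun _ => Iff.rfl)

theorem edgeCount_eq_zero {s r : E → V} {x y : V} (h : ∀ e, s e = x → r e ≠ y) :
    edgeCount s r x y = 0 :=
  have : IsEmpty {e // s e = x ∧ r e = y} := ⟨fun e => h e.1 e.2.1 e.2.2⟩
  Nat.card_of_isEmpty

theorem edgeCount_const [DecidableEq V] (x' y' x y : V) :
    edgeCount (fun _ : Unit => x') (fun _ => y') x y = if x' = x ∧ y' = y then 1 else 0 := by
  split_ifs with h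
  · simp [edgeCount, h]
  · exact edgeCount_eq_zero fun _ h₁ h₂ => h ⟨h₁, h₂⟩

theorem moveEquiv_ofMaps_of_edgeCount_eq [Finite V] [Finite E] [Finite F] {s r : E → V}
    {s' r' : F → V} (h : ∀ x y, edgeCount s r x y = edgeCount s' r' x y) :
    MoveEquiv (ofMaps s r) (ofMaps s' r') := by
  have key (p : V × V) : Nonempty ({e // (s e, r e) = p} ≃ {e // (s' e, r' e) = p}) := by
    refine Finite.card_eq.1 ?_
    simpa [edgeCount, Prod.ext_iff] using h p.1 p.2
  let φ := fun p => (key p).some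
  have hψ := fun e => ((φ (s e, r e)) ⟨e, rfl⟩).2
  refine moveEquiv_ofMaps_of_equiv
    ((Equiv.sigmaFiberEquiv fun e => (s e, r e)).symm.trans
      ((Equiv.sigmaCongrRight φ).trans (Equiv.sigmaFiberEquiv _))) ?_ ?_
  · exact fun e => congrArg Prod.fst (hψ e)
  · exact fun e => congrArg Prod.snd (hψ e)

section Steps

variable [Finite V] [DecidableEq V] [Finite E] [Finite F] {s r : E → V} {s' r' : F → V}
  {i j : V}

theorem moveEquiv_row_of_edgeCount (hij : i ≠ j) (h₁ : 0 < edgeCount s r i j)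
    (h₂ : 0 < edgeCount s r j j)
    (hi : ∀ y, edgeCount s' r' i y + (if j = y then 1 else 0) =
      edgeCount s r i y + edgeCount s r j y)
    (hk : ∀ x y, x ≠ i → edgeCount s' r' x y = edgeCount s r x y) :
    MoveEquiv (ofMaps s r) (ofMaps s' r') := by
  obtain ⟨f, hfs, hfr⟩ := (Nat.card_pos_iff.1 h₁).1
  obtain ⟨y₀, hys, hyr⟩ := (Nat.card_pos_iff.1 h₂).1
  let φ : ({e // s e ≠ j ∧ e ≠ f} ⊕ {e // s e = j}) ⊕ Unit ≃ E :=
    Equiv.ofBijective (Sum.elim (Sum.elim Subtype.val Subtype.val) fun _ => f) <| by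
      refine ⟨?_, fun e => ?_⟩
      · rintro ((⟨a, ha⟩ | ⟨a, ha⟩) | a) ((⟨b, hb⟩ | ⟨b, hb⟩) | b) h <;>
          simp only [Sum.elim_inl, Sum.elim_inr] at h <;> grind
      · by_cases h₁ : s e = j
        · exact ⟨.inl (.inr ⟨e, h₁⟩), rfl⟩
        · by_cases h₂ : e = f
          · exact ⟨.inr (), h₂.symm⟩
          · exact ⟨.inl (.inl ⟨e, h₁, h₂⟩), rfl⟩
  have hs : s ∘ φ = Sum.elim (Sum.elim (fun e => s e.1) fun _ => j) fun _ => i := by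
    funext e
    rcases e with (e | e) | e
    · rfl
    · exact e.2
    · exact hfs
  have hr : r ∘ φ = Sum.elim (Sum.elim (fun e => r e.1) fun e => r e.1) fun _ => j := by
    funext e
    rcases e with (e | e) | e
    · rfl
    · rfl
    · exact hfr
  have hstep := moveEquiv_row_ofMaps (fun e : {e // s e ≠ j ∧ e ≠ f} => s e)
    (fun e => r e) (fun e : {e // s e = j} => r e) i j hij (fun e => e.2.1)
    ⟨y₀, hys⟩ hyr
  rw [← hs, ← hr] at hstep
  refine .trans (moveEquiv_ofMaps_of_equiv φ (fun _ => rfl) fun _ => rfl).symm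
    (.trans hstep (moveEquiv_ofMaps_of_edgeCount_eq fun x y => ?_))
  have hG (x y : V) := edgeCount_comp_equiv φ s r x y
  simp only [hs, hr, edgeCount_sumElim, edgeCount_const] at hG ⊢
  have hY (x' : V) : edgeCount (fun _ : {e // s e = j} => x') (fun e => r e) x' y =
      edgeCount s r j y :=
    Nat.card_congr ⟨fun e => ⟨e.1, e.1.2, e.2.2⟩, fun e => ⟨⟨e.1, e.2.1⟩, rfl, e.2.2⟩,
      fun _ => rfl, fun _ => rfl⟩
  by_cases hx : x = i
  · subst hx
    have := hG x y
    have := hi y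
    simp only [hY, true_and] at *
    omega
  · rw [hk x y hx, ← hG x y, edgeCount_eq_zero (s := fun _ => i) fun _ h => absurd h.symm hx]
    simp [Ne.symm hx]

theorem moveEquiv_column_of_edgeCount (hij : i ≠ j) (h₁ : 0 < edgeCount s r j i)
    (h₂ : 0 < edgeCount s r j j)
    (hi : ∀ x, edgeCount s' r' x i + (if j = x then 1 else 0) =
      edgeCount s r x i + edgeCount s r x j)
    (hk : ∀ x y, y ≠ i → edgeCount s' r' x y = edgeCount s r x y) :
    MoveEquiv (ofMaps s r) (ofMaps s' r') := by
  obtain ⟨f, hfs, hfr⟩ := (Nat.card_pos_iff.1 h₁).1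
  obtain ⟨y₀, hys, hyr⟩ := (Nat.card_pos_iff.1 h₂).1
  let φ : ({e // r e ≠ j ∧ e ≠ f} ⊕ {e // r e = j}) ⊕ Unit ≃ E :=
    Equiv.ofBijective (Sum.elim (Sum.elim Subtype.val Subtype.val) fun _ => f) <| by
      refine ⟨?_, fun e => ?_⟩
      · rintro ((⟨a, ha⟩ | ⟨a, ha⟩) | a) ((⟨b, hb⟩ | ⟨b, hb⟩) | b) h <;>
          simp only [Sum.elim_inl, Sum.elim_inr] at h <;> grind
      · by_cases h₁ : r e = j
        · exact ⟨.inl (.inr ⟨e, h₁⟩), rfl⟩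
        · by_cases h₂ : e = f
          · exact ⟨.inr (), h₂.symm⟩
          · exact ⟨.inl (.inl ⟨e, h₁, h₂⟩), rfl⟩
  have hs : s ∘ φ = Sum.elim (Sum.elim (fun e => s e.1) fun e => s e.1) fun _ => j := by
    funext e
    rcases e with (e | e) | e
    · rfl
    · rfl
    · exact hfs
  have hr : r ∘ φ = Sum.elim (Sum.elim (fun e => r e.1) fun _ => j) fun _ => i := by
    funext e
    rcases e with (e | e) | e
    · rfl
    · exact e.2
    · exact hfr
  have hstep := moveEquiv_column_ofMaps (fun e : {e // r e ≠ j ∧ e ≠ f} => s e)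
    (fun e => r e) (fun e : {e // r e = j} => s e) i j hij (fun e => e.2.1)
    ⟨y₀, hyr⟩ hys
  rw [← hs, ← hr] at hstep
  refine .trans (moveEquiv_ofMaps_of_equiv φ (fun _ => rfl) fun _ => rfl).symm
    (.trans hstep (moveEquiv_ofMaps_of_edgeCount_eq fun x y => ?_))
  have hG (x y : V) := edgeCount_comp_equiv φ s r x y
  simp only [hs, hr, edgeCount_sumElim, edgeCount_const] at hG ⊢
  have hY (y' : V) : edgeCount (fun e : {e // r e = j} => s e) (fun _ => y') x y' =
      edgeCount s r x j :=
    Nat.card_congr ⟨fun e => ⟨e.1, e.2.1, e.1.2⟩, fun e => ⟨⟨e.1, e.2.2⟩, e.2.1, rfl⟩,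
      fun _ => rfl, fun _ => rfl⟩
  by_cases hy : y = i
  · subst hy
    have := hG x y
    have := hi x
    simp only [hY, and_true] at *
    omega
  · rw [hk x y hy, ← hG x y, edgeCount_eq_zero (r := fun _ => i) fun _ _ h => hy h.symm]
    simp [Ne.symm hy]

end Steps

end EdgeCount

end CKGraph

section Matrix

open CKGraph

variable {n : ℕ}

instance finite_graphOfMatrix_V (A : Matrix (Fin n) (Fin n) ℕ∞) : Finite (graphOfMatrix A).V :=
  inferInstanceAs (Finite (Fin n))

/-- The edges from `x` to `y` of the graph of a matrix with entries in `ℕ`. -/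
def edgeEquiv (A : Matrix (Fin n) (Fin n) ℕ) :
    (graphOfMatrix (A.map ((↑) : ℕ → ℕ∞))).E ≃ Σ x : Fin n, Σ y : Fin n, Fin (A x y) :=
  Equiv.sigmaCongrRight fun x => Equiv.sigmaCongrRight fun y =>
    (Equiv.subtypeEquivRight fun _ => by simp).trans Fin.equivSubtype.symm

instance finite_graphOfMatrix_E (A : Matrix (Fin n) (Fin n) ℕ) :
    Finite (graphOfMatrix (A.map ((↑) : ℕ → ℕ∞))).E :=
  have (x : Fin n) : Finite (Σ y : Fin n, Fin (A x y)) := inferInstance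
  .of_equiv _ (edgeEquiv A).symm

theorem edgeCount_graphOfMatrix (A : Matrix (Fin n) (Fin n) ℕ) (x y : Fin n) :
    edgeCount (V := Fin n) (graphOfMatrix (A.map ((↑) : ℕ → ℕ∞))).s
      (graphOfMatrix (A.map ((↑) : ℕ → ℕ∞))).r x y = A x y := by
  let φ : {e : (graphOfMatrix (A.map ((↑) : ℕ → ℕ∞))).E // e.1 = x ∧ e.2.1 = y} ≃ Fin (A x y) :=
    ((edgeEquiv A).subtypeEquiv (q := fun e => e.1 = x ∧ e.2.1 = y) fun _ => Iff.rfl).trans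
      { toFun := fun e => Fin.cast (congrArg₂ A e.2.1 e.2.2) e.1.2.2
        invFun := fun k => ⟨⟨x, y, k⟩, rfl, rfl⟩
        left_inv := by rintro ⟨⟨x, y, k⟩, rfl, rfl⟩; rfl
        right_inv := fun _ => rfl }
  exact (Nat.card_congr φ).trans (by simp)

theorem matMoveEquiv_row {M M' : Matrix (Fin n) (Fin n) ℕ} {i j : Fin n} (hij : i ≠ j)
    (hM : 0 < M i j) (hi : ∀ y, M' i y = M i y + M j y) (hk : ∀ x, x ≠ i → M' x = M x) :
    MatMoveEquiv ((1 + M).map ((↑) : ℕ → ℕ∞)) ((1 + M').map ((↑) : ℕ → ℕ∞)) := by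
  refine moveEquiv_row_of_edgeCount (V := Fin n)
    (s := (graphOfMatrix ((1 + M).map ((↑) : ℕ → ℕ∞))).s)
    (r := (graphOfMatrix ((1 + M).map ((↑) : ℕ → ℕ∞))).r)
    (s' := (graphOfMatrix ((1 + M').map ((↑) : ℕ → ℕ∞))).s)
    (r' := (graphOfMatrix ((1 + M').map ((↑) : ℕ → ℕ∞))).r) (i := i) (j := j) hij ?_ ?_ ?_ ?_ <;>
    simp only [edgeCount_graphOfMatrix]
  · simp [hM]
  · simp
  · intro y
    simp only [Matrix.add_apply, hi, Matrix.one_apply]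
    ring
  · intro x y hx
    simp [hk x hx]

theorem matMoveEquiv_column {M M' : Matrix (Fin n) (Fin n) ℕ} {i j : Fin n} (hij : i ≠ j)
    (hM : 0 < M j i) (hi : ∀ x, M' x i = M x i + M x j)
    (hk : ∀ x y, y ≠ i → M' x y = M x y) :
    MatMoveEquiv ((1 + M).map ((↑) : ℕ → ℕ∞)) ((1 + M').map ((↑) : ℕ → ℕ∞)) := by
  refine moveEquiv_column_of_edgeCount (V := Fin n)
    (s := (graphOfMatrix ((1 + M).map ((↑) : ℕ → ℕ∞))).s)
    (r := (graphOfMatrix ((1 + M).map ((↑) : ℕ → ℕ∞))).r)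
    (s' := (graphOfMatrix ((1 + M').map ((↑) : ℕ → ℕ∞))).s)
    (r' := (graphOfMatrix ((1 + M').map ((↑) : ℕ → ℕ∞))).r) (i := i) (j := j) hij ?_ ?_ ?_ ?_ <;>
    simp only [edgeCount_graphOfMatrix]
  · simp [hM]
  · simp
  · intro x
    simp only [Matrix.add_apply, hi, Matrix.one_apply, eq_comm (a := j)]
    ring
  · intro x y hy
    simp [hk x y hy]

/-- If one may add the vector `b k` to any vector with positive `k`-th entry, and `i` reaches `j`
along the positive entries of `b`, then one may add `b j` to `b i`. -/
theorem add_of_reachable {ι : Type*} {R : (ι → ℕ) → (ι → ℕ) → Prop} (hR : Equivalence R)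
    {b : ι → ι → ℕ} {i j : ι} (hij : i ≠ j)
    (hstep : ∀ v k, k ≠ i → 0 < v k → R v (v + b k))
    (h : Relation.ReflTransGen (fun k l => k = l ∨ 0 < b k l) i j) : R (b i) (b i + b j) := by
  suffices H : (i ≠ i ∧ ∀ v, 0 < v i → R v (v + b j)) ∨ R (b i) (b i + b j) from
    H.resolve_left fun H => H.1 rfl
  refine h.head_induction_on
    (motive := fun k _ => (k ≠ i ∧ ∀ v, 0 < v k → R v (v + b j)) ∨ R (b i) (b i + b j))
    (.inl ⟨hij.symm, fun v => hstep v j hij.symm⟩) fun {k l} hkl _ ih => ?_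
  rcases ih with ⟨hl, ih⟩ | ih
  · rcases hkl with rfl | hkl
    · exact .inl ⟨hl, ih⟩
    · by_cases hk : k = i
      · exact .inr (ih _ (hk ▸ hkl))
      · refine .inl ⟨hk, fun v hv => ?_⟩
        have h₁ := hR.trans (hstep v k hk hv) (ih (v + b k) (Nat.add_pos_right _ hkl))
        have h₂ := hstep (v + b j) k hk (Nat.add_pos_left hv _)
        rw [add_right_comm] at h₁
        exact hR.trans h₁ (hR.symm h₂)
  · exact .inr ih

theorem MatMoveEquiv.refl (A : Matrix (Fin n) (Fin n) ℕ∞) : MatMoveEquiv A A :=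
  .of_iso inferInstance ⟨⟨Equiv.refl _, Equiv.refl _, fun _ => rfl, fun _ => rfl⟩⟩

theorem MatIrreducible.reflTransGen {B : Matrix (Fin n) (Fin n) ℕ} (h : MatIrreducible (1 + B))
    (i j : Fin n) : Relation.ReflTransGen (fun k l => k = l ∨ 0 < B k l) i j := by
  obtain ⟨l, c, -, rfl, rfl, hc⟩ := h i j
  induction l with
  | zero => exact .refl
  | succ l ih =>
    refine .tail (ih fun t ht => hc t (ht.trans l.lt_succ_self)) ?_
    have := hc l l.lt_succ_self
    by_cases hl : c l = c (l + 1)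
    · exact .inl hl
    · exact .inr (Nat.pos_of_ne_zero (by simpa [Matrix.one_apply_ne hl] using this))

end Matrix

/-- for `A = I + B` irreducible, row and column additions on `B`
preserve the move-equivalence class of `A`. -/
theorem stmt10 {n : ℕ} (B B' : Matrix (Fin n) (Fin n) ℕ)
    (hirr : MatIrreducible (1 + B))
    (hB' : (∃ i j : Fin n, i ≠ j ∧
        B' = Matrix.of fun k l => if k = i then B i l + B j l else B k l) ∨
      (∃ i j : Fin n, i ≠ j ∧
        B' = Matrix.of fun k l => if l = i then B k i + B k j else B k l)) :
    MatMoveEquiv ((1 + B).map ((↑) : ℕ → ℕ∞))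
      ((1 + B').map ((↑) : ℕ → ℕ∞)) := by
  rcases hB' with ⟨i, j, hij, rfl⟩ | ⟨i, j, hij, rfl⟩
  · let f (v : Fin n → ℕ) : Matrix (Fin n) (Fin n) ℕ∞ := (1 + B.updateRow i v).map (↑)
    have hR : Equivalence fun v w => MatMoveEquiv (f v) (f w) :=
      ⟨fun _ => .refl _, .symm, .trans⟩
    have key := add_of_reachable hR (b := B) hij
      (fun v k hk hv => matMoveEquiv_row hk.symm (by simpa using hv)
        (fun y => by simp [hk]) fun x hx => by simp [Matrix.updateRow_ne hx])
      (hirr.reflTransGen i j)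
    convert key using 3
    · simp
    · ext k l
      by_cases hk : k = i <;> simp [hk, Matrix.updateRow_apply]
  · let f (v : Fin n → ℕ) : Matrix (Fin n) (Fin n) ℕ∞ := (1 + B.updateCol i v).map (↑)
    have hR : Equivalence fun v w => MatMoveEquiv (f v) (f w) :=
      ⟨fun _ => .refl _, .symm, .trans⟩
    have key := add_of_reachable hR (b := B.transpose) hij
      (fun v k hk hv => matMoveEquiv_column hk.symm (by simpa using hv)
        (fun y => by simp [hk]) fun x y hy => by simp [Matrix.updateCol_ne hy])
      (.lift id (fun _ _ h => h.elim (fun e => .inl e.symm) .inr) _ _ (hirr.reflTransGen j i).swap)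
    convert key using 3
    · exact (Matrix.updateCol_eq_self B i).symm
    · ext k l
      by_cases hl : l = i <;> simp [hl]
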